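/- For all N ≥ 4 and 1 ≤ K ≤ N−2, the QCF operator satisfies L^{qcf} = (L¹)^{−1} L^{qnl} L¹; consequently L^{qcf} is diagonalizable and its spectrum equals the spectrum of L^{qnl}. -/

import Mathlib

/-- Discrete Dirichlet Laplacian. -/
noncomputable def L1 (ε : ℝ) (v : ℤ → ℝ) (j : ℤ) : ℝ :=
  (-v (j + 1) + 2 * v j - v (j - 1)) / ε ^ 2

/-- Linearized atomistic operator. -/
noncomputable def La (ε φF φ2F : ℝ) (v : ℤ → ℝ) (j : ℤ) : ℝ :=
  φF * ((-v (j + 1) + 2 * v j - v (j - 1)) / ε ^ 2)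
    + φ2F * ((-v (j + 2) + 2 * v j - v (j - 2)) / ε ^ 2)

/-- Linearized force-based QC operator: atomistic forces on A = {-K,…,K},
local continuum (QCL) forces elsewhere. -/
noncomputable def Lqcf (K : ℕ) (ε φF φ2F : ℝ) (v : ℤ → ℝ) (j : ℤ) : ℝ :=
  if |j| ≤ (K : ℤ) then La ε φF φ2F v j else (φF + 4 * φ2F) * L1 ε v j

/-- The QNL operator at indices `0 ≤ j`. -/
noncomputable def qnlBody (K : ℕ) (ε φF φ2F : ℝ) (v : ℤ → ℝ) (j : ℤ) : ℝ :=
  φF * ((-v (j + 1) + 2 * v j - v (j - 1)) / ε ^ 2) +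
    φ2F *
      (if j ≤ (K : ℤ) - 1 then
        4 * ((-v (j + 2) + 2 * v j - v (j - 2)) / (4 * ε ^ 2))
      else if j = (K : ℤ) then
        4 * ((-v (j + 2) + 2 * v j - v (j - 2)) / (4 * ε ^ 2))
          - (-v (j + 2) + 2 * v (j + 1) - v j) / ε ^ 2
      else if j = (K : ℤ) + 1 then
        4 * ((-v (j + 1) + 2 * v j - v (j - 1)) / ε ^ 2)
          + (-v j + 2 * v (j - 1) - v (j - 2)) / ε ^ 2
      else 4 * ((-v (j + 1) + 2 * v j - v (j - 1)) / ε ^ 2))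

/-- The QNL operator, defined for `j < 0` by symmetry. -/
noncomputable def Lqnl (K : ℕ) (ε φF φ2F : ℝ) (v : ℤ → ℝ) (j : ℤ) : ℝ :=
  if 0 ≤ j then qnlBody K ε φF φ2F v j
  else qnlBody K ε φF φ2F (fun ℓ => v (-ℓ)) (-j)

open Matrix

/-- Interior lattice indices of the chain `{-N, …, N}`. -/
abbrev Interior (N : ℕ) : Type := {j : ℤ // j ∈ Finset.Icc (-(N : ℤ) + 1) ((N : ℤ) - 1)}

/-- Extension by zero from the interior indices to all of `ℤ`. -/
noncomputable def zeroExt (N : ℕ) : (Interior N → ℝ) →ₗ[ℝ] (ℤ → ℝ) where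
  toFun x j := if h : j ∈ Finset.Icc (-(N : ℤ) + 1) ((N : ℤ) - 1) then x ⟨j, h⟩ else 0
  map_add' x y := by
    funext j
    by_cases h : j ∈ Finset.Icc (-(N : ℤ) + 1) ((N : ℤ) - 1) <;> simp only [h, dite_true,
      dite_false, Pi.add_apply, add_zero]
  map_smul' c x := by
    funext j
    by_cases h : j ∈ Finset.Icc (-(N : ℤ) + 1) ((N : ℤ) - 1) <;> simp only [h, dite_true,
      dite_false, Pi.smul_apply, smul_zero, RingHom.id_apply]

theorem mem_interior_iff {N : ℕ} {j : ℤ} :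
    j ∈ Finset.Icc (-(N : ℤ) + 1) ((N : ℤ) - 1) ↔ |j| < (N : ℤ) := by
  rw [Finset.mem_Icc, abs_lt]
  omega

theorem zeroExt_apply_coe {N : ℕ} (x : Interior N → ℝ) (j : Interior N) :
    zeroExt N x j = x j := by
  simp only [zeroExt, LinearMap.coe_mk, AddHom.coe_mk, j.2, dite_true]

theorem zeroExt_apply_of_le {N : ℕ} (x : Interior N → ℝ) {j : ℤ} (hj : (N : ℤ) ≤ |j|) :
    zeroExt N x j = 0 := by
  have h : j ∉ Finset.Icc (-(N : ℤ) + 1) ((N : ℤ) - 1) := by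
    rw [mem_interior_iff]; omega
  simp only [zeroExt, LinearMap.coe_mk, AddHom.coe_mk, h, dite_false]

theorem zeroExt_injective (N : ℕ) : Function.Injective (zeroExt N) := by
  intro x y h
  funext j
  rw [← zeroExt_apply_coe x, h, zeroExt_apply_coe]

theorem zeroExt_restrict {N : ℕ} (f : ℤ → ℝ) :
    zeroExt N (fun j => f j) = fun j : ℤ => if |j| < (N : ℤ) then f j else 0 := by
  funext j
  simp only [zeroExt, LinearMap.coe_mk, AddHom.coe_mk, mem_interior_iff, dite_eq_ite]

theorem exists_zeroExt_eq {N : ℕ} {v : ℤ → ℝ} (hv : ∀ j : ℤ, (N : ℤ) ≤ |j| → v j = 0) :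
    ∃ x, zeroExt N x = v := by
  refine ⟨fun j => v j, ?_⟩
  rw [zeroExt_restrict]
  funext j
  split_ifs with h
  · rfl
  · exact (hv j (not_lt.mp h)).symm

theorem sum_interior_ite {N : ℕ} (x : Interior N → ℝ) (k : ℤ) :
    ∑ i : Interior N, (if (i : ℤ) = k then x i else 0) = zeroExt N x k := by
  by_cases h : k ∈ Finset.Icc (-(N : ℤ) + 1) ((N : ℤ) - 1)
  · have hk : ∀ i : Interior N, (i : ℤ) = k ↔ i = ⟨k, h⟩ := fun i => by
      rw [Subtype.ext_iff]
    simp only [hk, Finset.sum_ite_eq', Finset.mem_univ, if_true]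
    exact (zeroExt_apply_coe x ⟨k, h⟩).symm
  · rw [zeroExt_apply_of_le x (not_lt.mp (mt mem_interior_iff.mpr h))]
    refine Finset.sum_eq_zero fun i _ => if_neg ?_
    rintro rfl
    exact h i.2

/-- Second difference matrix with Dirichlet boundary conditions. -/
def dirichletMatrix (N : ℕ) : Matrix (Interior N) (Interior N) ℝ :=
  Matrix.of fun i j => (if (j : ℤ) = i then 2 else 0) - (if (j : ℤ) = i + 1 then 1 else 0)
    - (if (j : ℤ) = i - 1 then 1 else 0)

/-- Diagonal projection onto the atomistic region `{-K, …, K}`. -/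
def atomisticProjection (N K : ℕ) : Matrix (Interior N) (Interior N) ℝ :=
  Matrix.diagonal fun i => if |(i : ℤ)| ≤ (K : ℤ) then 1 else 0

/-- Matrix of the force-based operator. -/
noncomputable def qcfMatrix (N K : ℕ) (ε φF φ2F : ℝ) : Matrix (Interior N) (Interior N) ℝ :=
  (ε ^ 2)⁻¹ • ((φF + 4 * φ2F) • dirichletMatrix N
    - φ2F • (atomisticProjection N K * (dirichletMatrix N * dirichletMatrix N)))

/-- Matrix of the quasi-nonlocal operator. -/
noncomputable def qnlMatrix (N K : ℕ) (ε φF φ2F : ℝ) : Matrix (Interior N) (Interior N) ℝ :=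
  (ε ^ 2)⁻¹ • ((φF + 4 * φ2F) • dirichletMatrix N
    - φ2F • (dirichletMatrix N * atomisticProjection N K * dirichletMatrix N))

theorem dirichletMatrix_mul_qcfMatrix (N K : ℕ) (ε φF φ2F : ℝ) :
    dirichletMatrix N * qcfMatrix N K ε φF φ2F
      = qnlMatrix N K ε φF φ2F * dirichletMatrix N := by
  simp only [qcfMatrix, qnlMatrix, Matrix.mul_smul, Matrix.smul_mul, Matrix.mul_sub,
    Matrix.sub_mul, Matrix.mul_assoc]

theorem dirichletMatrix_transpose (N : ℕ) : (dirichletMatrix N)ᵀ = dirichletMatrix N := by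
  ext i j
  simp only [dirichletMatrix, Matrix.transpose_apply, Matrix.of_apply]
  have h0 : (i : ℤ) = j ↔ (j : ℤ) = i := eq_comm
  have h1 : (i : ℤ) = j + 1 ↔ (j : ℤ) = i - 1 := by omega
  have h2 : (i : ℤ) = j - 1 ↔ (j : ℤ) = i + 1 := by omega
  simp only [h0, h1, h2]
  ring

theorem qnlMatrix_isHermitian (N K : ℕ) (ε φF φ2F : ℝ) :
    (qnlMatrix N K ε φF φ2F).IsHermitian := by
  rw [Matrix.IsHermitian, Matrix.conjTranspose_eq_transpose_of_trivial]
  simp only [qnlMatrix, atomisticProjection, Matrix.transpose_smul, Matrix.transpose_sub,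
    Matrix.transpose_mul, Matrix.diagonal_transpose, dirichletMatrix_transpose,
    Matrix.mul_assoc]

theorem zeroExt_dirichletMatrix_mulVec {N : ℕ} (x : Interior N → ℝ) (j : ℤ) :
    zeroExt N (dirichletMatrix N *ᵥ x) j = if |j| < (N : ℤ) then
      -zeroExt N x (j + 1) + 2 * zeroExt N x j - zeroExt N x (j - 1) else 0 := by
  have key : dirichletMatrix N *ᵥ x = fun i : Interior N =>
      -zeroExt N x (i + 1) + 2 * zeroExt N x i - zeroExt N x (i - 1) := by
    funext i
    simp only [← sum_interior_ite, Matrix.mulVec, dotProduct, dirichletMatrix, Matrix.of_apply,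
      sub_mul, ite_mul, zero_mul, one_mul, Finset.sum_sub_distrib, Finset.mul_sum, mul_ite,
      mul_zero]
    ring
  rw [key, zeroExt_restrict
    (fun j => -zeroExt N x (j + 1) + 2 * zeroExt N x j - zeroExt N x (j - 1))]

theorem zeroExt_atomisticProjection_mulVec {N K : ℕ} (x : Interior N → ℝ) (j : ℤ) :
    zeroExt N (atomisticProjection N K *ᵥ x) j
      = if |j| ≤ (K : ℤ) then zeroExt N x j else 0 := by
  by_cases h : |j| < (N : ℤ)
  · have := zeroExt_apply_coe (atomisticProjection N K *ᵥ x) ⟨j, mem_interior_iff.mpr h⟩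
    have h' := zeroExt_apply_coe x ⟨j, mem_interior_iff.mpr h⟩
    simp only at this h'
    rw [this, h', atomisticProjection, Matrix.mulVec_diagonal, ite_mul, one_mul, zero_mul]
  · rw [zeroExt_apply_of_le _ (not_lt.mp h), zeroExt_apply_of_le _ (not_lt.mp h), ite_self]

theorem L1_zeroExt {N : ℕ} (ε : ℝ) (x : Interior N → ℝ) {j : ℤ} (hj : |j| < (N : ℤ)) :
    L1 ε (zeroExt N x) j = zeroExt N ((ε ^ 2)⁻¹ • (dirichletMatrix N *ᵥ x)) j := by
  rw [map_smul, Pi.smul_apply, zeroExt_dirichletMatrix_mulVec, if_pos hj, L1, smul_eq_mul]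
  ring

theorem Lqcf_zeroExt {N K : ℕ} (hK : K + 2 ≤ N) (ε φF φ2F : ℝ) (x : Interior N → ℝ) {j : ℤ}
    (hj : |j| < (N : ℤ)) :
    Lqcf K ε φF φ2F (zeroExt N x) j = zeroExt N (qcfMatrix N K ε φF φ2F *ᵥ x) j := by
  simp only [qcfMatrix, Matrix.smul_mulVec, Matrix.sub_mulVec, ← Matrix.mulVec_mulVec, map_smul,
    map_sub, Pi.smul_apply, Pi.sub_apply, smul_eq_mul, zeroExt_atomisticProjection_mulVec,
    zeroExt_dirichletMatrix_mulVec, if_pos hj, Lqcf, La, L1]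
  split_ifs with h h1 h2 h2
  · rw [show j + 1 + 1 = j + 2 by ring, show j - 1 - 1 = j - 2 by ring,
      show j + 1 - 1 = j by ring, show j - 1 + 1 = j by ring]
    ring
  · rw [abs_le] at h
    exact absurd (abs_lt.mpr ⟨by omega, by omega⟩) h2
  · rw [abs_le] at h
    exact absurd (abs_lt.mpr ⟨by omega, by omega⟩) h1
  · rw [abs_le] at h
    exact absurd (abs_lt.mpr ⟨by omega, by omega⟩) h1
  · ring

theorem Lqnl_zeroExt {N K : ℕ} (hK1 : 1 ≤ K) (hK : K + 2 ≤ N) (ε φF φ2F : ℝ)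
    (x : Interior N → ℝ) {j : ℤ} (hj : |j| < (N : ℤ)) :
    Lqnl K ε φF φ2F (zeroExt N x) j = zeroExt N (qnlMatrix N K ε φF φ2F *ᵥ x) j := by
  have inner : ∀ i : ℤ, zeroExt N (atomisticProjection N K *ᵥ (dirichletMatrix N *ᵥ x)) i
      = if -(K : ℤ) ≤ i ∧ i ≤ K then
        -zeroExt N x (i + 1) + 2 * zeroExt N x i - zeroExt N x (i - 1) else 0 := by
    intro i
    rw [zeroExt_atomisticProjection_mulVec, zeroExt_dirichletMatrix_mulVec]
    simp only [abs_le]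
    split_ifs with h1 h2
    · rfl
    · exact absurd (abs_lt.mpr ⟨by omega, by omega⟩) h2
    · rfl
  simp only [qnlMatrix, Matrix.smul_mulVec, Matrix.sub_mulVec, ← Matrix.mulVec_mulVec, map_smul,
    map_sub, Pi.smul_apply, Pi.sub_apply, smul_eq_mul, zeroExt_dirichletMatrix_mulVec (j := j),
    if_pos hj, inner, Lqnl, qnlBody]
  rw [show j + 1 + 1 = j + 2 by ring, show j - 1 - 1 = j - 2 by ring,
    show j + 1 - 1 = j by ring, show j - 1 + 1 = j by ring,
    show -(-j + 1) = j - 1 by ring, show -(-j + 2) = j - 2 by ring,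
    show -(-j - 1) = j + 1 by ring, show -(-j - 2) = j + 2 by ring, neg_neg]
  split_ifs <;> first
    | (exfalso; omega)
    | ring

theorem dirichletMatrix_mulVec_injective (N : ℕ) :
    Function.Injective (dirichletMatrix N).mulVec := by
  rw [← Matrix.coe_mulVecLin, ← LinearMap.ker_eq_bot, LinearMap.ker_eq_bot']
  intro x hx
  rw [Matrix.mulVecLin_apply] at hx
  have hrec : ∀ j : ℤ, |j| < (N : ℤ) →
      zeroExt N x (j + 1) = 2 * zeroExt N x j - zeroExt N x (j - 1) := by
    intro j hj
    have h := zeroExt_dirichletMatrix_mulVec x j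
    rw [hx, map_zero, if_pos hj, Pi.zero_apply] at h
    linarith
  have hlin : ∀ k : ℕ, k < 2 * N →
      zeroExt N x (-N + k) = k * zeroExt N x (-N + 1) ∧
      zeroExt N x (-N + k + 1) = (k + 1) * zeroExt N x (-N + 1) := by
    intro k
    induction k with
    | zero =>
      intro _
      have h0 : zeroExt N x (-N) = 0 := zeroExt_apply_of_le x (by simp)
      simp [h0]
    | succ k ih =>
      intro hk
      obtain ⟨h1, h2⟩ := ih (by omega)
      have h3 := hrec (-N + k + 1) (by rw [abs_lt]; omega)
      rw [show (-N + k + 1 - 1 : ℤ) = -N + k by ring, h1, h2] at h3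
      push_cast
      rw [← add_assoc]
      exact ⟨h2, by rw [h3]; ring⟩
  funext i
  have hi := mem_interior_iff.mp i.2
  rw [abs_lt] at hi
  have hslope : zeroExt N x (-N + 1) = 0 := by
    obtain ⟨-, h⟩ := hlin (2 * N - 1) (by omega)
    rw [zeroExt_apply_of_le x (by rw [le_abs]; omega)] at h
    refine (mul_eq_zero.mp h.symm).resolve_left ?_
    positivity
  obtain ⟨h, -⟩ := hlin ((i : ℤ) + N).toNat (by omega)
  rw [hslope, mul_zero, show (-N + (((i : ℤ) + N).toNat : ℤ) : ℤ) = i by omega,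
    zeroExt_apply_coe] at h
  exact h

theorem zeroExt_eigen_iff {N : ℕ} {L : (ℤ → ℝ) → ℤ → ℝ} {M : Matrix (Interior N) (Interior N) ℝ}
    (hL : ∀ (x : Interior N → ℝ) {j : ℤ}, |j| < (N : ℤ) →
      L (zeroExt N x) j = zeroExt N (M *ᵥ x) j) (μ : ℝ) (x : Interior N → ℝ) :
    (∀ j ∈ Finset.Icc (-(N : ℤ) + 1) ((N : ℤ) - 1), L (zeroExt N x) j = μ * zeroExt N x j)
      ↔ M *ᵥ x = μ • x := by
  constructor
  · intro h
    funext i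
    have := h i i.2
    rwa [hL x (mem_interior_iff.mp i.2), zeroExt_apply_coe, zeroExt_apply_coe] at this
  · intro h j hj
    rw [hL x (mem_interior_iff.mp hj), h, map_smul, Pi.smul_apply, smul_eq_mul]

theorem exists_eigenfunction_iff {N : ℕ} {L : (ℤ → ℝ) → ℤ → ℝ}
    {M : Matrix (Interior N) (Interior N) ℝ}
    (hL : ∀ (x : Interior N → ℝ) {j : ℤ}, |j| < (N : ℤ) →
      L (zeroExt N x) j = zeroExt N (M *ᵥ x) j) (μ : ℝ) :
    (∃ v : ℤ → ℝ, (∀ j : ℤ, (N : ℤ) ≤ |j| → v j = 0) ∧ v ≠ 0 ∧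
        ∀ j ∈ Finset.Icc (-(N : ℤ) + 1) ((N : ℤ) - 1), L v j = μ * v j)
      ↔ ∃ x : Interior N → ℝ, x ≠ 0 ∧ M *ᵥ x = μ • x := by
  constructor
  · rintro ⟨v, hv, hv0, h⟩
    obtain ⟨x, rfl⟩ := exists_zeroExt_eq hv
    exact ⟨x, fun hx => hv0 (by rw [hx, map_zero]), (zeroExt_eigen_iff hL μ x).mp h⟩
  · rintro ⟨x, hx, h⟩
    exact ⟨zeroExt N x, fun _ => zeroExt_apply_of_le x,
      (map_ne_zero_iff _ (zeroExt_injective N)).mpr hx, (zeroExt_eigen_iff hL μ x).mpr h⟩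

/-- An operator intertwined with a real symmetric matrix by an injective one has a full family of
eigenvectors. -/
theorem exists_linearIndependent_eigenvectors {n : Type*} [Fintype n] [DecidableEq n]
    {D F Q : Matrix n n ℝ} (hD : Function.Injective D.mulVec) (hQ : Q.IsHermitian)
    (hDF : D * F = Q * D) :
    ∃ (x : n → n → ℝ) (μ : n → ℝ), LinearIndependent ℝ x ∧ ∀ i, F *ᵥ x i = μ i • x i := by
  have hsurj : Function.Surjective D.mulVecLin := LinearMap.injective_iff_surjective.mp hD
  choose x hx using fun i => hsurj (hQ.eigenvectorBasis i).ofLp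
  refine ⟨x, hQ.eigenvalues, ?_, fun i => hD ?_⟩
  · refine LinearIndependent.of_comp D.mulVecLin ?_
    have h := hQ.eigenvectorBasis.toBasis.linearIndependent.map'
      (WithLp.linearEquiv 2 ℝ (n → ℝ)).toLinearMap (LinearEquiv.ker _)
    have hcomp : D.mulVecLin ∘ x = (WithLp.linearEquiv 2 ℝ (n → ℝ)).toLinearMap ∘
        hQ.eigenvectorBasis.toBasis := by
      funext i
      simp only [Function.comp_apply, hx i, OrthonormalBasis.coe_toBasis, LinearEquiv.coe_coe,
        WithLp.linearEquiv_apply]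
      rfl
    rw [hcomp]
    exact h
  · have hxi : D *ᵥ x i = (hQ.eigenvectorBasis i).ofLp := hx i
    change D *ᵥ (F *ᵥ x i) = D *ᵥ (hQ.eigenvalues i • x i)
    rw [Matrix.mulVec_mulVec, hDF, ← Matrix.mulVec_mulVec, Matrix.mulVec_smul, hxi,
      hQ.mulVec_eigenvectorBasis]

/-- Matrices intertwined by an injective one have the same eigenvalues. -/
theorem exists_eigenvector_iff_of_intertwined {n : Type*} [Fintype n] [DecidableEq n]
    {D F Q : Matrix n n ℝ} (hD : Function.Injective D.mulVec) (hDF : D * F = Q * D) (μ : ℝ) :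
    (∃ x : n → ℝ, x ≠ 0 ∧ F *ᵥ x = μ • x) ↔ ∃ y : n → ℝ, y ≠ 0 ∧ Q *ᵥ y = μ • y := by
  have hcomm : ∀ x, D *ᵥ (F *ᵥ x) = Q *ᵥ (D *ᵥ x) := fun x => by
    rw [Matrix.mulVec_mulVec, hDF, Matrix.mulVec_mulVec]
  have hsurj : Function.Surjective D.mulVecLin := LinearMap.injective_iff_surjective.mp hD
  constructor
  · rintro ⟨x, hx, h⟩
    refine ⟨D *ᵥ x, fun h0 => hx (hD ?_), by rw [← hcomm, h, Matrix.mulVec_smul]⟩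
    rw [h0, Matrix.mulVec_zero]
  · rintro ⟨y, hy, h⟩
    obtain ⟨x, rfl⟩ := hsurj y
    rw [Matrix.mulVecLin_apply] at hy h
    refine ⟨x, fun h0 => hy (by rw [h0, Matrix.mulVec_zero]), hD ?_⟩
    rw [hcomm, h, Matrix.mulVec_smul]

/-- L^{qcf} = (L¹)⁻¹ L^{qnl} L¹, i.e. L¹ L^{qcf} = L^{qnl} L¹ on U;
consequently L^{qcf} is diagonalizable (admits a basis of eigenvectors) and its
spectrum coincides with that of L^{qnl}. -/
theorem qcf_conjugate_to_qnl
    (N K : ℕ) (hN : 4 ≤ N) (hK1 : 1 ≤ K) (hK2 : K + 2 ≤ N)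
    (ε φF φ2F : ℝ) (hε : ε = 1 / N) :
    (∀ v : ℤ → ℝ, (∀ j : ℤ, (N : ℤ) ≤ |j| → v j = 0) →
      ∀ j ∈ Finset.Icc (-(N : ℤ) + 1) ((N : ℤ) - 1),
        L1 ε (fun i => if |i| < (N : ℤ) then Lqcf K ε φF φ2F v i else 0) j
          = Lqnl K ε φF φ2F (fun i => if |i| < (N : ℤ) then L1 ε v i else 0) j) ∧
    (∃ (V : Fin (2 * N - 1) → ℤ → ℝ) (μ : Fin (2 * N - 1) → ℝ),
      (∀ i, ∀ j : ℤ, (N : ℤ) ≤ |j| → V i j = 0) ∧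
      LinearIndependent ℝ V ∧
      (∀ i, ∀ j ∈ Finset.Icc (-(N : ℤ) + 1) ((N : ℤ) - 1),
        Lqcf K ε φF φ2F (V i) j = μ i * V i j)) ∧
    (∀ μ : ℝ,
      (∃ v : ℤ → ℝ, (∀ j : ℤ, (N : ℤ) ≤ |j| → v j = 0) ∧ v ≠ 0 ∧
        ∀ j ∈ Finset.Icc (-(N : ℤ) + 1) ((N : ℤ) - 1),
          Lqcf K ε φF φ2F v j = μ * v j) ↔
      (∃ w : ℤ → ℝ, (∀ j : ℤ, (N : ℤ) ≤ |j| → w j = 0) ∧ w ≠ 0 ∧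
        ∀ j ∈ Finset.Icc (-(N : ℤ) + 1) ((N : ℤ) - 1),
          Lqnl K ε φF φ2F w j = μ * w j)) := by
  have hqcf := fun (x : Interior N → ℝ) {j : ℤ} (hj : |j| < (N : ℤ)) =>
    Lqcf_zeroExt hK2 ε φF φ2F x hj
  have hqnl := fun (x : Interior N → ℝ) {j : ℤ} (hj : |j| < (N : ℤ)) =>
    Lqnl_zeroExt hK1 hK2 ε φF φ2F x hj
  have hD := dirichletMatrix_mulVec_injective N
  have hDF := dirichletMatrix_mul_qcfMatrix N K ε φF φ2F
  refine ⟨?_, ?_, fun μ => ?_⟩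
  · intro v hv j hj
    obtain ⟨x, rfl⟩ := exists_zeroExt_eq hv
    rw [mem_interior_iff] at hj
    have h1 : (fun i : ℤ => if |i| < (N : ℤ) then Lqcf K ε φF φ2F (zeroExt N x) i else 0)
        = zeroExt N (qcfMatrix N K ε φF φ2F *ᵥ x) := by
      funext i
      split_ifs with h
      · exact hqcf x h
      · exact (zeroExt_apply_of_le _ (not_lt.mp h)).symm
    have h2 : (fun i : ℤ => if |i| < (N : ℤ) then L1 ε (zeroExt N x) i else 0)
        = zeroExt N ((ε ^ 2)⁻¹ • (dirichletMatrix N *ᵥ x)) := by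
      funext i
      split_ifs with h
      · exact L1_zeroExt ε x h
      · exact (zeroExt_apply_of_le _ (not_lt.mp h)).symm
    rw [h1, h2, L1_zeroExt ε _ hj, hqnl _ hj, Matrix.mulVec_mulVec, hDF, Matrix.mulVec_smul,
      Matrix.mulVec_mulVec]
  · obtain ⟨x, μ, hx, h⟩ :=
      exists_linearIndependent_eigenvectors hD (qnlMatrix_isHermitian N K ε φF φ2F) hDF
    have hcard : Fintype.card (Interior N) = 2 * N - 1 := by
      rw [Fintype.card_coe, Int.card_Icc]
      omega
    let e : Fin (2 * N - 1) ≃ Interior N := (Fintype.equivFinOfCardEq hcard).symm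
    refine ⟨fun i => zeroExt N (x (e i)), fun i => μ (e i), fun i j => zeroExt_apply_of_le _, ?_,
      fun i => (zeroExt_eigen_iff hqcf _ _).mpr (h (e i))⟩
    exact (hx.comp e e.injective).map' (zeroExt N)
      (LinearMap.ker_eq_bot.mpr (zeroExt_injective N))
  · rw [exists_eigenfunction_iff hqcf, exists_eigenfunction_iff hqnl]
    exact exists_eigenvector_iff_of_intertwined hD hDF μ
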